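/- Let ζ_1,…,ζ_5 be n×n complex matrices with all pairwise differences invertible. Let L be the 4n×7n matrix obtained by vertically concatenating the matrices f_3^{full} of tetrahedra 1234 and 1235, zero-extended over the face list 123, 124, 125, 134, 135, 234, 235, and let R be the 6n×9n matrix obtained by vertically concatenating the zero-extended matrices f_3^{full} of tetrahedra 1245, 2345, 1345 over the face list 124, 125, 134, 135, 234, 235, 145, 245, 345. Then the projection of the kernel of L onto the boundary coordinates (the 6n coordinates belonging to faces 124, 125, 134, 135, 234, 235) coincides with the projection of the kernel of R onto the same boundary coordinates, and this common subspace of (ℂ^n)^6 has dimension 3n. -/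

import Mathlib

/-- A `b·n × c·n` matrix assembled from `n × n` blocks. -/
def ofBlocks {b c n : ℕ} (B : Fin b → Fin c → Matrix (Fin n) (Fin n) ℂ) :
    Matrix (Fin (b * n)) (Fin (c * n)) ℂ :=
  Matrix.of fun i j =>
    B ⟨(i : ℕ) / n, by
        rcases Nat.eq_zero_or_pos n with h | h
        · exact absurd i.isLt (by simp [h])
        · exact (Nat.div_lt_iff_lt_mul h).2 i.isLt⟩
      ⟨(j : ℕ) / n, by
        rcases Nat.eq_zero_or_pos n with h | h
        · exact absurd j.isLt (by simp [h])
        · exact (Nat.div_lt_iff_lt_mul h).2 j.isLt⟩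
      ⟨(i : ℕ) % n, Nat.mod_lt _ (by
        rcases Nat.eq_zero_or_pos n with h | h
        · exact absurd i.isLt (by simp [h])
        · exact h)⟩
      ⟨(j : ℕ) % n, Nat.mod_lt _ (by
        rcases Nat.eq_zero_or_pos n with h | h
        · exact absurd j.isLt (by simp [h])
        · exact h)⟩

/-- The `4 × 7` block structure of the matrix `(f₃^full)` for the left-hand side of the
Pachner move 2→3 (the two tetrahedra `1234`, `1235`, here with vertices `0,…,4 : Fin 5`):
block rows correspond to `dψ_{1,1234}`, `dψ_{2,1234}`, `dψ_{1,1235}`, `dψ_{2,1235}`, block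
columns to the faces `123, 124, 125, 134, 135, 234, 235`; formula (21) of the paper. -/
noncomputable def LBlocks {n : ℕ} (ζ : Fin 5 → Matrix (Fin n) (Fin n) ℂ) :
    Fin 4 → Fin 7 → Matrix (Fin n) (Fin n) ℂ :=
  ![![1, -1, 0, 1, 0, 0, 0],
    ![(ζ 1 - ζ 2)⁻¹ * (ζ 2 - ζ 0), -((ζ 1 - ζ 3)⁻¹ * (ζ 3 - ζ 0)), 0, 0, 0, -1, 0],
    ![1, 0, -1, 0, 1, 0, 0],
    ![(ζ 1 - ζ 2)⁻¹ * (ζ 2 - ζ 0), 0, -((ζ 1 - ζ 4)⁻¹ * (ζ 4 - ζ 0)), 0, 0, 0, -1]]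

/-- The face carried by each of the `7` block columns of the matrix `L`. -/
def LFaces : Fin 7 → Fin 5 × Fin 5 × Fin 5 :=
  ![(0, 1, 2), (0, 1, 3), (0, 1, 4), (0, 2, 3), (0, 2, 4), (1, 2, 3), (1, 2, 4)]

/-- The `6 × 9` block structure of the matrix `(f₃^full)` for the right-hand side of the
Pachner move 2→3 (the three tetrahedra `1245`, `2345`, `1345`): block rows correspond to
`dψ_{1,1245}`, `dψ_{2,1245}`, `dψ_{2,2345}`, `dψ_{3,2345}`, `dψ_{1,1345}`, `dψ_{3,1345}`,
block columns to the faces `124, 125, 134, 135, 234, 235, 145, 245, 345`. -/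
noncomputable def RBlocks {n : ℕ} (ζ : Fin 5 → Matrix (Fin n) (Fin n) ℂ) :
    Fin 6 → Fin 9 → Matrix (Fin n) (Fin n) ℂ :=
  ![![1, -1, 0, 0, 0, 0, 1, 0, 0],
    ![(ζ 1 - ζ 3)⁻¹ * (ζ 3 - ζ 0), -((ζ 1 - ζ 4)⁻¹ * (ζ 4 - ζ 0)), 0, 0, 0, 0, 0, -1, 0],
    ![0, 0, 0, 0, 1, -1, 0, 1, 0],
    ![0, 0, 0, 0, (ζ 2 - ζ 3)⁻¹ * (ζ 3 - ζ 1), -((ζ 2 - ζ 4)⁻¹ * (ζ 4 - ζ 1)), 0, 0, -1],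
    ![0, 0, 1, -1, 0, 0, 1, 0, 0],
    ![0, 0, (ζ 2 - ζ 3)⁻¹ * (ζ 3 - ζ 0), -((ζ 2 - ζ 4)⁻¹ * (ζ 4 - ζ 0)), 0, 0, 0, 0, -1]]

/-- The face carried by each of the `9` block columns of the matrix `R`. -/
def RFaces : Fin 9 → Fin 5 × Fin 5 × Fin 5 :=
  ![(0, 1, 3), (0, 1, 4), (0, 2, 3), (0, 2, 4), (1, 2, 3), (1, 2, 4),
    (0, 3, 4), (1, 3, 4), (2, 3, 4)]

/-- The matrix `(f₃^full)_{l.h.s.}` of the left-hand side of the Pachner move. -/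
noncomputable def Lmat {n : ℕ} (ζ : Fin 5 → Matrix (Fin n) (Fin n) ℂ) :
    Matrix (Fin (4 * n)) (Fin (7 * n)) ℂ :=
  ofBlocks (LBlocks ζ)

/-- The matrix `(f₃^full)_{r.h.s.}` of the right-hand side of the Pachner move. -/
noncomputable def Rmat {n : ℕ} (ζ : Fin 5 → Matrix (Fin n) (Fin n) ℂ) :
    Matrix (Fin (6 * n)) (Fin (9 * n)) ℂ :=
  ofBlocks (RBlocks ζ)

/-- The set of inner columns of `L`: the `n` columns of the face `123`. -/
def LInner (n : ℕ) : Finset (Fin (7 * n)) :=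
  Finset.univ.filter fun j => (j : ℕ) < n

/-- The set of inner columns of `R`: the `3n` columns of the faces `145, 245, 345`. -/
def RInner (n : ℕ) : Finset (Fin (9 * n)) :=
  Finset.univ.filter fun j => 6 * n ≤ (j : ℕ)

/-- The projection onto the boundary coordinates of the left-hand-side configuration:
the boundary faces of `L` are its block columns `1,…,6` (faces `124, 125, 134, 135, 234,
235`), each contributing `n` coordinates. -/
noncomputable def projL (n : ℕ) : (Fin (7 * n) → ℂ) →ₗ[ℂ] (Fin (6 * n) → ℂ) :=
  LinearMap.funLeft ℂ ℂ fun b : Fin (6 * n) =>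
    (⟨n + (b : ℕ), by have := b.isLt; omega⟩ : Fin (7 * n))

/-- The projection onto the boundary coordinates of the right-hand-side configuration:
the boundary faces of `R` are its block columns `0,…,5` (the same faces `124, 125, 134,
135, 234, 235`, in the same order). -/
noncomputable def projR (n : ℕ) : (Fin (9 * n) → ℂ) →ₗ[ℂ] (Fin (6 * n) → ℂ) :=
  LinearMap.funLeft ℂ ℂ (Fin.castLE (by omega : 6 * n ≤ 9 * n))

open Matrix

/-- The `k`-th block of length `n` of a vector of length `c * n`. -/
def vecBlock {c n : ℕ} (x : Fin (c * n) → ℂ) (k : Fin c) : Fin n → ℂ :=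
  fun i => x (finProdFinEquiv (k, i))

/-- The vector of length `c * n` with prescribed blocks. -/
def ofVecBlocks {c n : ℕ} (v : Fin c → Fin n → ℂ) : Fin (c * n) → ℂ :=
  fun j => v (finProdFinEquiv.symm j).1 (finProdFinEquiv.symm j).2

@[simp]
theorem vecBlock_ofVecBlocks {c n : ℕ} (v : Fin c → Fin n → ℂ) (k : Fin c) :
    vecBlock (ofVecBlocks v) k = v k := by
  ext i
  simp only [vecBlock, ofVecBlocks, Equiv.symm_apply_apply]

theorem vecBlock_ext {c n : ℕ} {x y : Fin (c * n) → ℂ}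
    (h : ∀ k, vecBlock x k = vecBlock y k) : x = y := by
  ext j
  have := congrFun (h (finProdFinEquiv.symm j).1) (finProdFinEquiv.symm j).2
  simpa only [vecBlock, Prod.mk.eta, Equiv.apply_symm_apply] using this

theorem vecBlock_zero {c n : ℕ} (k : Fin c) : vecBlock (0 : Fin (c * n) → ℂ) k = 0 := rfl

theorem ofBlocks_apply {b c n : ℕ} (B : Fin b → Fin c → Matrix (Fin n) (Fin n) ℂ)
    (k : Fin b) (l : Fin c) (i j : Fin n) :
    ofBlocks B (finProdFinEquiv (k, i)) (finProdFinEquiv (l, j)) = B k l i j := by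
  have hn : 0 < n := i.pos
  have hdiv : ∀ (a : ℕ) (m : Fin n), ((m : ℕ) + n * a) / n = a := fun a m => by
    rw [Nat.add_mul_div_left _ _ hn, Nat.div_eq_of_lt m.isLt, zero_add]
  have hmod : ∀ (a : ℕ) (m : Fin n), ((m : ℕ) + n * a) % n = m := fun a m => by
    rw [Nat.add_mul_mod_self_left, Nat.mod_eq_of_lt m.isLt]
  simp only [ofBlocks, Matrix.of_apply, finProdFinEquiv_apply_val, hdiv, hmod]

theorem vecBlock_ofBlocks_mulVec {b c n : ℕ} (B : Fin b → Fin c → Matrix (Fin n) (Fin n) ℂ)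
    (x : Fin (c * n) → ℂ) (k : Fin b) :
    vecBlock (ofBlocks B *ᵥ x) k = ∑ l, B k l *ᵥ vecBlock x l := by
  ext i
  simp only [vecBlock, Matrix.mulVec, dotProduct, Finset.sum_apply]
  rw [← finProdFinEquiv.sum_comp, Fintype.sum_prod_type]
  simp only [ofBlocks_apply]

theorem vecBlock_projL {n : ℕ} (x : Fin (7 * n) → ℂ) (k : Fin 6) :
    vecBlock (projL n x) k = vecBlock x k.succ := by
  ext i
  simp only [vecBlock, projL, LinearMap.funLeft_apply]
  congr 1
  ext
  simp only [finProdFinEquiv_apply_val, Fin.val_succ]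
  ring

theorem vecBlock_projR {n : ℕ} (x : Fin (9 * n) → ℂ) (k : Fin 6) :
    vecBlock (projR n x) k = vecBlock x (Fin.castLE (by omega) k) := by
  ext i
  simp only [vecBlock, projR, LinearMap.funLeft_apply]
  congr 1

theorem ofBlocks_mulVec_eq_zero_iff {b c n : ℕ}
    (B : Fin b → Fin c → Matrix (Fin n) (Fin n) ℂ) (x : Fin (c * n) → ℂ) :
    ofBlocks B *ᵥ x = 0 ↔ ∀ k, ∑ l, B k l *ᵥ vecBlock x l = 0 := by
  constructor
  · intro h k
    rw [← vecBlock_ofBlocks_mulVec, h, vecBlock_zero]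
  · intro h
    refine vecBlock_ext fun k => ?_
    rw [vecBlock_ofBlocks_mulVec, h, vecBlock_zero]

/-- The relation on the boundary blocks `124, 125, 134, 135, 234, 235` cut out by `L`. -/
def LRel {n : ℕ} (ζ : Fin 5 → Matrix (Fin n) (Fin n) ℂ) (v : Fin 6 → Fin n → ℂ) : Prop :=
  v 0 - v 2 = v 1 - v 3 ∧
  v 4 = ((ζ 1 - ζ 2)⁻¹ * (ζ 2 - ζ 0)) *ᵥ (v 0 - v 2) - ((ζ 1 - ζ 3)⁻¹ * (ζ 3 - ζ 0)) *ᵥ v 0 ∧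
  v 5 = ((ζ 1 - ζ 2)⁻¹ * (ζ 2 - ζ 0)) *ᵥ (v 0 - v 2) - ((ζ 1 - ζ 4)⁻¹ * (ζ 4 - ζ 0)) *ᵥ v 1

/-- The relation on the boundary blocks `124, 125, 134, 135, 234, 235` cut out by `R`. -/
def RRel {n : ℕ} (ζ : Fin 5 → Matrix (Fin n) (Fin n) ℂ) (v : Fin 6 → Fin n → ℂ) : Prop :=
  v 1 - v 0 = v 3 - v 2 ∧
  ((ζ 1 - ζ 3)⁻¹ * (ζ 3 - ζ 0)) *ᵥ v 0 - ((ζ 1 - ζ 4)⁻¹ * (ζ 4 - ζ 0)) *ᵥ v 1 = v 5 - v 4 ∧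
  ((ζ 2 - ζ 3)⁻¹ * (ζ 3 - ζ 1)) *ᵥ v 4 - ((ζ 2 - ζ 4)⁻¹ * (ζ 4 - ζ 1)) *ᵥ v 5 =
    ((ζ 2 - ζ 3)⁻¹ * (ζ 3 - ζ 0)) *ᵥ v 2 - ((ζ 2 - ζ 4)⁻¹ * (ζ 4 - ζ 0)) *ᵥ v 3

theorem Lmat_mulVec_eq_zero_iff {n : ℕ} (ζ : Fin 5 → Matrix (Fin n) (Fin n) ℂ)
    (x : Fin (7 * n) → ℂ) :
    Lmat ζ *ᵥ x = 0 ↔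
      vecBlock x 0 = vecBlock x 1 - vecBlock x 3 ∧ LRel ζ fun k => vecBlock x k.succ := by
  rw [Lmat, ofBlocks_mulVec_eq_zero_iff]
  simp only [Fin.forall_fin_succ, Fin.sum_univ_succ, LBlocks, LRel]
  simp [Matrix.neg_mulVec]
  constructor
  · rintro ⟨h₁, h₂, h₃, h₄⟩
    have h₀ : vecBlock x 0 = vecBlock x 1 - vecBlock x 3 := by linear_combination h₁
    rw [← h₀]
    exact ⟨rfl, by linear_combination h₃, by linear_combination -h₂, by linear_combination -h₄⟩
  · rintro ⟨h₀, h₁, h₂, h₃⟩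
    rw [← h₀] at h₁ h₂ h₃
    exact ⟨by linear_combination h₀, by linear_combination -h₂, by linear_combination h₁,
      by linear_combination -h₃⟩

theorem Rmat_mulVec_eq_zero_iff {n : ℕ} (ζ : Fin 5 → Matrix (Fin n) (Fin n) ℂ)
    (x : Fin (9 * n) → ℂ) :
    Rmat ζ *ᵥ x = 0 ↔
      (vecBlock x 6 = vecBlock x 1 - vecBlock x 0 ∧ vecBlock x 7 = vecBlock x 5 - vecBlock x 4 ∧
        vecBlock x 8 = ((ζ 2 - ζ 3)⁻¹ * (ζ 3 - ζ 1)) *ᵥ vecBlock x 4 -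
          ((ζ 2 - ζ 4)⁻¹ * (ζ 4 - ζ 1)) *ᵥ vecBlock x 5) ∧
      RRel ζ fun k => vecBlock x (Fin.castLE (by omega) k) := by
  rw [Rmat, ofBlocks_mulVec_eq_zero_iff]
  simp only [Fin.forall_fin_succ, Fin.sum_univ_succ, RBlocks, RRel]
  simp [Matrix.neg_mulVec]
  constructor
  · rintro ⟨h₁, h₂, h₃, h₄, h₅, h₆⟩
    exact ⟨⟨by linear_combination h₁, by linear_combination h₃, by linear_combination -h₄⟩,
      by linear_combination h₅ - h₁, by linear_combination h₂ + h₃, by linear_combination h₄ - h₆⟩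
  · rintro ⟨⟨h₁, h₂, h₃⟩, h₄, h₅, h₆⟩
    exact ⟨by linear_combination h₁, by linear_combination h₅ - h₂, by linear_combination h₂,
      by linear_combination -h₃, by linear_combination h₁ + h₄, by linear_combination -h₃ - h₆⟩

theorem mem_map_projL_iff {n : ℕ} (ζ : Fin 5 → Matrix (Fin n) (Fin n) ℂ)
    (y : Fin (6 * n) → ℂ) :
    y ∈ Submodule.map (projL n) (LinearMap.ker (Lmat ζ).mulVecLin) ↔ LRel ζ (vecBlock y) := by
  simp only [Submodule.mem_map, LinearMap.mem_ker, Matrix.mulVecLin_apply,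
    Lmat_mulVec_eq_zero_iff]
  constructor
  · rintro ⟨x, ⟨-, hx⟩, rfl⟩
    simpa only [← vecBlock_projL] using hx
  · intro hy
    refine ⟨ofVecBlocks (Fin.cons (vecBlock y 0 - vecBlock y 2) (vecBlock y)), ⟨?_, ?_⟩, ?_⟩
    · simp only [vecBlock_ofVecBlocks]
      rfl
    · simpa only [vecBlock_ofVecBlocks, Fin.cons_succ] using hy
    · refine vecBlock_ext fun k => ?_
      rw [vecBlock_projL, vecBlock_ofVecBlocks, Fin.cons_succ]

theorem mem_map_projR_iff {n : ℕ} (ζ : Fin 5 → Matrix (Fin n) (Fin n) ℂ)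
    (y : Fin (6 * n) → ℂ) :
    y ∈ Submodule.map (projR n) (LinearMap.ker (Rmat ζ).mulVecLin) ↔ RRel ζ (vecBlock y) := by
  simp only [Submodule.mem_map, LinearMap.mem_ker, Matrix.mulVecLin_apply,
    Rmat_mulVec_eq_zero_iff]
  constructor
  · rintro ⟨x, ⟨-, hx⟩, rfl⟩
    simpa only [← vecBlock_projR] using hx
  · intro hy
    have hcast : ∀ (w : Fin 3 → Fin n → ℂ) (k : Fin 6),
        (Fin.append (vecBlock y) w : Fin 9 → Fin n → ℂ) (Fin.castLE (by omega) k)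
          = vecBlock y k := fun w k => Fin.append_left _ w k
    refine ⟨ofVecBlocks (Fin.append (vecBlock y) ![vecBlock y 1 - vecBlock y 0,
      vecBlock y 5 - vecBlock y 4, ((ζ 2 - ζ 3)⁻¹ * (ζ 3 - ζ 1)) *ᵥ vecBlock y 4 -
          ((ζ 2 - ζ 4)⁻¹ * (ζ 4 - ζ 1)) *ᵥ vecBlock y 5] : Fin 9 → Fin n → ℂ),
      ⟨⟨?_, ?_, ?_⟩, ?_⟩, ?_⟩
    · simp only [vecBlock_ofVecBlocks]
      rfl
    · simp only [vecBlock_ofVecBlocks]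
      rfl
    · simp only [vecBlock_ofVecBlocks]
      rfl
    · simpa only [vecBlock_ofVecBlocks, hcast] using hy
    · refine vecBlock_ext fun k => ?_
      rw [vecBlock_projR, vecBlock_ofVecBlocks, hcast]

theorem LRel_iff_RRel {n : ℕ} (ζ : Fin 5 → Matrix (Fin n) (Fin n) ℂ)
    (hζ : ∀ i j : Fin 5, i ≠ j → IsUnit (ζ i - ζ j)) (v : Fin 6 → Fin n → ℂ) :
    LRel ζ v ↔ RRel ζ v := by
  have hdet : ∀ i j : Fin 5, i ≠ j → IsUnit (ζ i - ζ j).det := fun i j h =>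
    (Matrix.isUnit_iff_isUnit_det _).1 (hζ i j h)
  have hcomp : ∀ k : Fin 5, k ≠ 1 →
      (ζ 2 - ζ k)⁻¹ * (ζ k - ζ 1) * ((ζ 1 - ζ k)⁻¹ * (ζ k - ζ 0)) =
        -((ζ 2 - ζ k)⁻¹ * (ζ k - ζ 0)) := fun k hk => by
    rw [← neg_sub (ζ 1) (ζ k), mul_neg, neg_mul, Matrix.mul_assoc,
      Matrix.mul_nonsing_inv_cancel_left _ _ (hdet 1 k hk.symm)]
  have hshift : ∀ k i : Fin 5, k ≠ 2 →
      (ζ 2 - ζ k)⁻¹ * (ζ k - ζ i) = (ζ 2 - ζ k)⁻¹ * (ζ 2 - ζ i) - 1 := fun k i hk => by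
    rw [← Matrix.nonsing_inv_mul _ (hdet 2 k hk.symm), ← mul_sub]
    congr 1
    abel
  set K := (ζ 2 - ζ 3)⁻¹ - (ζ 2 - ζ 4)⁻¹ with hK
  have hKunit : IsUnit K := by
    have : K = (ζ 2 - ζ 3)⁻¹ * (ζ 3 - ζ 4) * (ζ 2 - ζ 4)⁻¹ := by
      have : ζ 3 - ζ 4 = (ζ 2 - ζ 4) - (ζ 2 - ζ 3) := by abel
      rw [this, mul_sub, sub_mul, Matrix.nonsing_inv_mul _ (hdet 2 3 (by decide)),
        Matrix.mul_assoc, Matrix.mul_nonsing_inv _ (hdet 2 4 (by decide)), mul_one, one_mul]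
    rw [this]
    exact (((Matrix.isUnit_nonsing_inv_iff).2 (hζ 2 3 (by decide))).mul
      (hζ 3 4 (by decide))).mul ((Matrix.isUnit_nonsing_inv_iff).2 (hζ 2 4 (by decide)))
  -- The last relation of `R` evaluated at the vectors parametrised by `a`, `w`, `p`, `q`.
  have key : ∀ a w p q : Fin n → ℂ,
      ((ζ 2 - ζ 3)⁻¹ * (ζ 3 - ζ 1)) *ᵥ (w - ((ζ 1 - ζ 3)⁻¹ * (ζ 3 - ζ 0)) *ᵥ p) -
          ((ζ 2 - ζ 4)⁻¹ * (ζ 4 - ζ 1)) *ᵥ (w - ((ζ 1 - ζ 4)⁻¹ * (ζ 4 - ζ 0)) *ᵥ q) =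
        ((ζ 2 - ζ 3)⁻¹ * (ζ 3 - ζ 0)) *ᵥ (p - a) - ((ζ 2 - ζ 4)⁻¹ * (ζ 4 - ζ 0)) *ᵥ (q - a) ↔
      w = ((ζ 1 - ζ 2)⁻¹ * (ζ 2 - ζ 0)) *ᵥ a := by
    intro a w p q
    simp only [Matrix.mulVec_sub, Matrix.mulVec_mulVec, hcomp 3 (by decide),
      hcomp 4 (by decide), Matrix.neg_mulVec]
    have hw : ((ζ 2 - ζ 3)⁻¹ * (ζ 3 - ζ 1)) *ᵥ w - ((ζ 2 - ζ 4)⁻¹ * (ζ 4 - ζ 1)) *ᵥ w =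
        -(K *ᵥ ((ζ 1 - ζ 2) *ᵥ w)) := by
      rw [hshift 3 1 (by decide), hshift 4 1 (by decide), ← Matrix.sub_mulVec,
        sub_sub_sub_cancel_right, ← sub_mul, ← hK, ← neg_sub (ζ 1), mul_neg,
        Matrix.neg_mulVec, Matrix.mulVec_mulVec]
    have ha : ((ζ 2 - ζ 3)⁻¹ * (ζ 3 - ζ 0)) *ᵥ a - ((ζ 2 - ζ 4)⁻¹ * (ζ 4 - ζ 0)) *ᵥ a =
        K *ᵥ ((ζ 2 - ζ 0) *ᵥ a) := by
      rw [hshift 3 0 (by decide), hshift 4 0 (by decide), ← Matrix.sub_mulVec,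
        sub_sub_sub_cancel_right, ← sub_mul, ← hK, Matrix.mulVec_mulVec]
    have hcancel : K *ᵥ ((ζ 1 - ζ 2) *ᵥ w) = K *ᵥ ((ζ 2 - ζ 0) *ᵥ a) ↔
        w = ((ζ 1 - ζ 2)⁻¹ * (ζ 2 - ζ 0)) *ᵥ a := by
      rw [(Matrix.mulVec_injective_of_isUnit hKunit).eq_iff]
      constructor
      · intro h
        rw [← Matrix.mulVec_mulVec, ← h, Matrix.mulVec_mulVec,
          Matrix.nonsing_inv_mul _ (hdet 1 2 (by decide)), Matrix.one_mulVec]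
      · rintro rfl
        rw [Matrix.mulVec_mulVec, Matrix.mul_nonsing_inv_cancel_left _ _ (hdet 1 2 (by decide))]
    rw [← hcancel, ← ha, ← neg_eq_iff_eq_neg.2 hw]
    constructor <;> intro h <;> linear_combination -h
  simp only [LRel, RRel]
  constructor
  · rintro ⟨h₁, h₂, h₃⟩
    refine ⟨by linear_combination -h₁, by rw [h₂, h₃]; abel, ?_⟩
    have h := (key (v 0 - v 2) _ (v 0) (v 1)).2 rfl
    rw [← h₂, ← h₃] at h
    rw [h, sub_sub_cancel, h₁, sub_sub_cancel]
  · rintro ⟨h₁, h₂, h₃⟩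
    have h₀ : v 0 - v 2 = v 1 - v 3 := by linear_combination -h₁
    have h := (key (v 0 - v 2) (v 4 + ((ζ 1 - ζ 3)⁻¹ * (ζ 3 - ζ 0)) *ᵥ v 0) (v 0) (v 1)).1 (by
      rw [add_sub_cancel_right, sub_sub_cancel, h₀, sub_sub_cancel, ← h₃]
      congr 2
      linear_combination h₂)
    refine ⟨h₀, ?_, ?_⟩
    · rw [← h, add_sub_cancel_right]
    · rw [← h]
      linear_combination -h₂

theorem Lmat_mulVec_surjective {n : ℕ} (ζ : Fin 5 → Matrix (Fin n) (Fin n) ℂ) :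
    Function.Surjective (Lmat ζ).mulVecLin := by
  intro y
  refine ⟨ofVecBlocks ![0, 0, 0, vecBlock y 0, vecBlock y 2, -vecBlock y 1, -vecBlock y 3],
    vecBlock_ext fun k => ?_⟩
  rw [Matrix.mulVecLin_apply, Lmat, vecBlock_ofBlocks_mulVec]
  fin_cases k <;> simp [Fin.sum_univ_succ, LBlocks, Matrix.neg_mulVec]

theorem finrank_map_projL {n : ℕ} (ζ : Fin 5 → Matrix (Fin n) (Fin n) ℂ) :
    Module.finrank ℂ
      (Submodule.map (projL n) (LinearMap.ker (Lmat ζ).mulVecLin)) = 3 * n := by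
  have hinj : Function.Injective
      ((projL n).domRestrict (LinearMap.ker (Lmat ζ).mulVecLin)) := by
    rw [injective_iff_map_eq_zero]
    rintro ⟨x, hx⟩ h
    rw [LinearMap.mem_ker, Matrix.mulVecLin_apply, Lmat_mulVec_eq_zero_iff] at hx
    have hz : ∀ k : Fin 6, vecBlock x k.succ = 0 := fun k => by
      rw [← vecBlock_projL, show projL n x = 0 from h, vecBlock_zero]
    refine Subtype.ext (vecBlock_ext fun k => ?_)
    refine Fin.cases ?_ (fun k => hz k) k
    exact hx.1.trans ((congrArg₂ _ (hz 0) (hz 2)).trans (sub_zero 0))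
  have hrank := LinearMap.finrank_range_add_finrank_ker (Lmat ζ).mulVecLin
  rw [LinearMap.range_eq_top.2 (Lmat_mulVec_surjective ζ), finrank_top, Module.finrank_fin_fun,
    Module.finrank_fin_fun] at hrank
  rw [← LinearMap.range_domRestrict, LinearMap.finrank_range_of_inj hinj]
  omega

/-- **The key step in the proof of the matrix pentagon equation** (Theorem 3 of the
paper): for `n×n` matrix coordinates `ζ_1, …, ζ_5` with all pairwise differences
invertible, the projection of the kernel of `L = (f₃^full)_{l.h.s.}` onto the boundary
coordinates (the `6n` coordinates of the faces `124, 125, 134, 135, 234, 235`) coincides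
with the projection of the kernel of `R = (f₃^full)_{r.h.s.}` onto the same boundary
coordinates, and this common subspace of `(ℂⁿ)⁶` has dimension `3n`. -/
theorem boundary_kernel_projections (n : ℕ) (ζ : Fin 5 → Matrix (Fin n) (Fin n) ℂ)
    (hζ : ∀ i j : Fin 5, i ≠ j → IsUnit (ζ i - ζ j)) :
    Submodule.map (projL n) (LinearMap.ker (Lmat ζ).mulVecLin)
        = Submodule.map (projR n) (LinearMap.ker (Rmat ζ).mulVecLin)
    ∧ Module.finrank ℂ
        (Submodule.map (projL n) (LinearMap.ker (Lmat ζ).mulVecLin)) = 3 * n := by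
  refine ⟨Submodule.ext fun y => ?_, finrank_map_projL ζ⟩
  rw [mem_map_projL_iff, mem_map_projR_iff, LRel_iff_RRel ζ hζ]
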